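/- arXiv:1609.07929 — 4 statements merged into one kernel-verified Lean document; each statement's English description precedes it below -/
import Mathlib

section
/- Let H be a real Hilbert space, let A ⊆ H be a bounded set, and write r(A) = sup{‖a‖ : a ∈ A}. If x belongs to the convex hull of A, then for every natural number N ≥ 1 there exist points x₁, …, x_N ∈ A (not necessarily distinct) such that ‖x − (1/N) ∑_{j=1}^N x_j‖ ≤ r(A)/√N. -/
/-- A linear functional attains on `A` at least its value at any point of the convex hull of `A`. -/
theorem exists_inner_le_of_mem_convexHull {H : Type*} [NormedAddCommGroup H]
    [InnerProductSpace ℝ H] {A : Set H} {x : H} (hx : x ∈ convexHull ℝ A) (u : H) :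
    ∃ a ∈ A, inner ℝ u x ≤ inner ℝ u a := by
  by_contra! h
  have hconv : Convex ℝ {a : H | inner ℝ u a < inner ℝ u x} :=
    convex_halfSpace_lt (innerₛₗ ℝ u).isLinear _
  have hlt : inner ℝ u x < inner ℝ u x := convexHull_min h hconv hx
  exact hlt.false

/-- A partial sum `v` can be extended by some `x - a` with `a ∈ A`, increasing the squared norm
by at most `r ^ 2`. -/
theorem exists_norm_add_sub_sq_le {H : Type*} [NormedAddCommGroup H]
    [InnerProductSpace ℝ H] {A : Set H} {r : ℝ} (hr : ∀ a ∈ A, ‖a‖ ≤ r) {x : H}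
    (hx : x ∈ convexHull ℝ A) (v : H) :
    ∃ a ∈ A, ‖v + (x - a)‖ ^ 2 ≤ ‖v‖ ^ 2 + r ^ 2 := by
  obtain ⟨a, ha, hle⟩ := exists_inner_le_of_mem_convexHull hx (v + x)
  refine ⟨a, ha, ?_⟩
  have har : ‖a‖ ^ 2 ≤ r ^ 2 := pow_le_pow_left₀ (norm_nonneg a) (hr a ha) 2
  have hsub := norm_sub_sq_real (v + x) a
  have hadd := norm_add_sq_real v x
  rw [inner_add_left v x x, real_inner_self_eq_norm_sq] at hle
  rw [← add_sub_assoc]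
  nlinarith [sq_nonneg ‖x‖]

theorem exists_norm_sum_sub_sq_le {H : Type*} [NormedAddCommGroup H]
    [InnerProductSpace ℝ H] {A : Set H} {r : ℝ} (hr : ∀ a ∈ A, ‖a‖ ≤ r) {x : H}
    (hx : x ∈ convexHull ℝ A) (N : ℕ) :
    ∃ y : Fin N → H, (∀ j, y j ∈ A) ∧ ‖∑ j, (x - y j)‖ ^ 2 ≤ N * r ^ 2 := by
  induction N with
  | zero => exact ⟨Fin.elim0, fun j => j.elim0, by simp⟩
  | succ n ih =>
    obtain ⟨y, hyA, hy⟩ := ih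
    obtain ⟨a, ha, hle⟩ := exists_norm_add_sub_sq_le hr hx (∑ j, (x - y j))
    refine ⟨Fin.snoc y a, Fin.lastCases (by simpa using ha) (by simpa using hyA), ?_⟩
    rw [Fin.sum_univ_castSucc]
    simp only [Fin.snoc_castSucc, Fin.snoc_last]
    push_cast
    linarith

/-- **Approximate Caratheodory theorem.** If `A` is a bounded subset of a real Hilbert
space `H` and `x ∈ conv(A)`, then for every `N ≥ 1` there are points `x₁, …, x_N ∈ A`
with `‖x - (1/N) ∑ xⱼ‖ ≤ r(A)/√N`, where `r(A) = sup {‖a‖ : a ∈ A}`. -/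
theorem approx_caratheodory {H : Type*} [NormedAddCommGroup H] [InnerProductSpace ℝ H]
    [CompleteSpace H] (A : Set H) (hA : Bornology.IsBounded A)
    (x : H) (hx : x ∈ convexHull ℝ A) (N : ℕ) (hN : 1 ≤ N) :
    ∃ y : Fin N → H, (∀ j, y j ∈ A) ∧
      ‖x - (N : ℝ)⁻¹ • ∑ j, y j‖ ≤ sSup ((fun a => ‖a‖) '' A) / Real.sqrt N := by
  have hbdd : BddAbove ((fun a => ‖a‖) '' A) := by
    obtain ⟨C, hC⟩ := hA.exists_norm_le
    exact ⟨C, by rintro _ ⟨a, ha, rfl⟩; exact hC a ha⟩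
  obtain ⟨y, hyA, hy⟩ := exists_norm_sum_sub_sq_le
    (fun a ha => le_csSup hbdd (Set.mem_image_of_mem _ ha)) hx N
  refine ⟨y, hyA, ?_⟩
  have hr : 0 ≤ sSup ((fun a => ‖a‖) '' A) :=
    Real.sSup_nonneg (by rintro _ ⟨a, -, rfl⟩; exact norm_nonneg a)
  have hN0 : (0 : ℝ) < N := by exact_mod_cast hN
  have hx_avg : x - (N : ℝ)⁻¹ • ∑ j, y j = (N : ℝ)⁻¹ • ∑ j, (x - y j) := by
    rw [Finset.sum_sub_distrib, smul_sub, Finset.sum_const, Finset.card_univ, Fintype.card_fin,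
      ← Nat.cast_smul_eq_nsmul ℝ, inv_smul_smul₀ hN0.ne']
  rw [hx_avg]
  refine (sq_le_sq₀ (norm_nonneg _) (by positivity)).mp ?_
  rw [norm_smul, mul_pow, div_pow, Real.sq_sqrt hN0.le, Real.norm_of_nonneg (by positivity)]
  calc ((N : ℝ)⁻¹) ^ 2 * ‖∑ j, (x - y j)‖ ^ 2
      ≤ ((N : ℝ)⁻¹) ^ 2 * (N * sSup ((fun a => ‖a‖) '' A) ^ 2) := by gcongr
    _ = sSup ((fun a => ‖a‖) '' A) ^ 2 / N := by field_simp
end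

section
/- Lemma of Johnson and Lindenstrauss: Let 0 < ε < 1 and let m, N, n be natural numbers with m ≥ 4(ε²/2 − ε³/3)^{-1} ln N. Then for every set of points x¹, …, x^N ∈ ℝⁿ there exists a (linear) mapping f : ℝⁿ → ℝ^m such that (1−ε)‖xⁱ − xʲ‖₂² ≤ ‖f(xⁱ) − f(xʲ)‖₂² ≤ (1+ε)‖xⁱ − xʲ‖₂² for all i, j ∈ {1, …, N}. -/
open MeasureTheory ProbabilityTheory Real Finset
open scoped RealInnerProductSpace

/-- The third-order Taylor polynomial bounds `log (1 + s)` from above. -/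
lemma log_one_add_le_cubic {s : ℝ} (hs : -1 < s) :
    log (1 + s) ≤ s - s ^ 2 / 2 + s ^ 3 / 3 := by
  let g : ℝ → ℝ := fun x ↦ x - x ^ 2 / 2 + x ^ 3 / 3 - log (1 + x)
  have hderiv : ∀ x, -1 < x → HasDerivAt g (x ^ 3 / (1 + x)) x := by
    intro x hx
    have hx' : 1 + x ≠ 0 := by linarith
    have h := ((((hasDerivAt_id x).sub (((hasDerivAt_id x).pow 2).div_const 2)).add
      (((hasDerivAt_id x).pow 3).div_const 3))).sub (((hasDerivAt_id x).const_add 1).log hx')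
    refine h.congr_deriv ?_
    simp only [id]
    field_simp
    ring
  have hcont : ContinuousOn g (Set.Ioi (-1)) :=
    fun x hx ↦ (hderiv x hx).continuousAt.continuousWithinAt
  have h0 : g 0 = 0 := by simp [g]
  suffices 0 ≤ g s by simp only [g] at this; linarith
  rw [← h0]
  rcases le_total 0 s with h | h
  · refine monotoneOn_of_hasDerivWithinAt_nonneg (f' := fun x ↦ x ^ 3 / (1 + x))
      (convex_Icc 0 s) (hcont.mono fun x hx ↦ ?_) (fun x hx ↦ ?_) (fun x hx ↦ ?_)
      (Set.left_mem_Icc.2 h) (Set.right_mem_Icc.2 h) h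
    · exact Set.mem_Ioi.2 (by linarith [hx.1])
    · rw [interior_Icc] at hx
      exact (hderiv x (by linarith [hx.1])).hasDerivWithinAt
    · rw [interior_Icc] at hx
      have := hx.1
      positivity
  · refine antitoneOn_of_hasDerivWithinAt_nonpos (f' := fun x ↦ x ^ 3 / (1 + x))
      (convex_Icc s 0) (hcont.mono fun x hx ↦ ?_) (fun x hx ↦ ?_) (fun x hx ↦ ?_)
      (Set.left_mem_Icc.2 h) (Set.right_mem_Icc.2 h) h
    · exact Set.mem_Ioi.2 (by linarith [hx.1])
    · rw [interior_Icc] at hx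
      exact (hderiv x (by linarith [hx.1])).hasDerivWithinAt
    · rw [interior_Icc] at hx
      exact div_nonpos_of_nonpos_of_nonneg (Odd.pow_nonpos (by decide) hx.2.le)
        (by linarith [hx.1])

/-- The moment generating function of the square of a standard Gaussian. -/
lemma integral_exp_mul_sq_gaussianReal {t : ℝ} (ht : t < 1 / 2) :
    ∫ y, exp (t * y ^ 2) ∂gaussianReal 0 1 = (√(1 - 2 * t))⁻¹ := by
  rw [integral_gaussianReal_eq_integral_smul one_ne_zero]
  have h : ∀ y : ℝ, gaussianPDFReal 0 1 y • exp (t * y ^ 2)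
      = (√(2 * π))⁻¹ * exp (-(1 / 2 - t) * y ^ 2) := by
    intro y
    rw [gaussianPDFReal_def, smul_eq_mul, mul_assoc, ← exp_add]
    simp only [NNReal.coe_one, mul_one, sub_zero]
    congr 2
    ring
  simp_rw [h]
  rw [integral_const_mul, integral_gaussian, ← sqrt_inv, ← sqrt_mul (by positivity), ← sqrt_inv]
  congr 1
  have : 1 - 2 * t ≠ 0 := by linarith
  have : 1 / 2 - t ≠ 0 := by linarith
  field_simp

section GaussianMatrix

variable {E : Type*} [NormedAddCommGroup E] [InnerProductSpace ℝ E]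

/-- The linear map whose coordinates are the inner products with the vectors `ω k`, normalized so
that a standard Gaussian `ω` preserves squared norms on average. -/
noncomputable def scaledInnerMap {m : ℕ} (ω : Fin m → E) : E →ₗ[ℝ] EuclideanSpace ℝ (Fin m) :=
  (WithLp.linearEquiv 2 ℝ (Fin m → ℝ)).symm.toLinearMap ∘ₗ
    LinearMap.pi fun k ↦ (√m)⁻¹ • (innerSL ℝ (ω k)).toLinearMap

lemma norm_sq_scaledInnerMap {m : ℕ} (ω : Fin m → E) (y : E) :
    ‖scaledInnerMap ω y‖ ^ 2 = (∑ k, ⟪y, ω k⟫ ^ 2) / m := by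
  rw [EuclideanSpace.real_norm_sq_eq, sum_div]
  refine sum_congr rfl fun k _ ↦ ?_
  simp [scaledInnerMap, mul_pow, real_inner_comm]
  ring

variable [FiniteDimensional ℝ E] [MeasurableSpace E] [BorelSpace E]

/-- One-dimensional marginals of the standard Gaussian are standard Gaussian. -/
lemma stdGaussian_map_inner {v : E} (hv : ‖v‖ = 1) :
    (stdGaussian E).map (fun g ↦ ⟪v, g⟫) = gaussianReal 0 1 := by
  have h := IsGaussian.map_eq_gaussianReal (μ := stdGaussian E) (innerSL ℝ v)
  rw [integral_strongDual_stdGaussian, variance_dual_stdGaussian, innerSL_apply_norm, hv] at h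
  simpa using h

lemma integral_exp_mul_sq_inner_stdGaussian {v : E} (hv : ‖v‖ = 1) {t : ℝ} (ht : t < 1 / 2) :
    ∫ g, exp (t * ⟪v, g⟫ ^ 2) ∂stdGaussian E = (√(1 - 2 * t))⁻¹ := by
  rw [← integral_exp_mul_sq_gaussianReal ht, ← stdGaussian_map_inner hv,
    integral_map (by fun_prop) (by fun_prop)]

/-- The exponential moment, at the optimal parameter `s / (2 * (1 + s))`, of the deviation of the
squared norm of a Gaussian projection of a unit vector from `1 + s` times its mean. -/
lemma integral_exp_sum_sq_inner_pi_stdGaussian {v : E} (hv : ‖v‖ = 1) {s : ℝ} (hs : -1 < s)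
    (m : ℕ) :
    ∫ ω : Fin m → E, exp (∑ k, (s / (2 * (1 + s)) * ⟪v, ω k⟫ ^ 2 - s / 2))
      ∂Measure.pi (fun _ ↦ stdGaussian E) = exp (-(m / 2 * (s - log (1 + s)))) := by
  have hs' : 0 < 1 + s := by linarith
  have hs1 : 1 - 2 * (s / (2 * (1 + s))) = (1 + s)⁻¹ := by field_simp; ring
  have ht : s / (2 * (1 + s)) < 1 / 2 := by
    have := inv_pos.2 hs'
    linarith
  simp_rw [exp_sum]
  rw [integral_fintype_prod_eq_pow
    (fun g : E ↦ exp (s / (2 * (1 + s)) * ⟪v, g⟫ ^ 2 - s / 2))]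
  simp_rw [exp_sub]
  rw [integral_div, integral_exp_mul_sq_inner_stdGaussian hv ht, hs1, sqrt_inv, inv_inv,
    sqrt_eq_rpow, rpow_def_of_pos hs', ← exp_sub, ← exp_nat_mul, Fintype.card_fin]
  congr 1
  ring

lemma integrable_exp_sum_sq_inner_pi_stdGaussian {v : E} (hv : ‖v‖ = 1) {s : ℝ} (hs : -1 < s)
    (m : ℕ) :
    Integrable (fun ω : Fin m → E ↦ exp (∑ k, (s / (2 * (1 + s)) * ⟪v, ω k⟫ ^ 2 - s / 2)))
      (Measure.pi fun _ ↦ stdGaussian E) := by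
  by_contra h
  have := integral_exp_sum_sq_inner_pi_stdGaussian hv hs m
  rw [integral_undef h] at this
  exact (exp_pos _).ne this

/-- A finite set of nonzero vectors that is not too large is mapped almost isometrically to
`ℝ^m` by some linear map. -/
lemma exists_linearMap_norm_sq_bounds {ε : ℝ} (hε0 : 0 < ε) (hε1 : ε < 1) (m : ℕ) (V : Finset E)
    (hV0 : ∀ v ∈ V, v ≠ 0) (hV : 2 * #V * exp (-(m / 2 * (ε ^ 2 / 2 - ε ^ 3 / 3))) < 1) :
    ∃ f : E →ₗ[ℝ] EuclideanSpace ℝ (Fin m), ∀ v ∈ V,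
      (1 - ε) * ‖v‖ ^ 2 ≤ ‖f v‖ ^ 2 ∧ ‖f v‖ ^ 2 ≤ (1 + ε) * ‖v‖ ^ 2 := by
  let F : ℝ → E → (Fin m → E) → ℝ := fun s v ω ↦
    exp (∑ k, (s / (2 * (1 + s)) * ⟪‖v‖⁻¹ • v, ω k⟫ ^ 2 - s / 2))
  let P : Measure (Fin m → E) := Measure.pi fun _ ↦ stdGaussian E
  have hnorm : ∀ v ∈ V, ‖‖v‖⁻¹ • v‖ = 1 := fun v hv ↦ norm_smul_inv_norm (𝕜 := ℝ) (hV0 v hv)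
  have hF_integrable : ∀ s, -1 < s → ∀ v ∈ V, Integrable (F s v) P := fun s hs v hv ↦
    integrable_exp_sum_sq_inner_pi_stdGaussian (hnorm v hv) hs m
  have hbound : ∀ s, -1 < s → ε ^ 2 / 2 - ε ^ 3 / 3 ≤ s ^ 2 / 2 - s ^ 3 / 3 → ∀ v ∈ V,
      ∫ ω, F s v ω ∂P ≤ exp (-(m / 2 * (ε ^ 2 / 2 - ε ^ 3 / 3))) := by
    intro s hs hsε v hv
    refine (integral_exp_sum_sq_inner_pi_stdGaussian (hnorm v hv) hs m).trans_le ?_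
    have := log_one_add_le_cubic hs
    refine exp_le_exp.2 (neg_le_neg (mul_le_mul_of_nonneg_left ?_ (by positivity)))
    linarith
  have hF_integrable_add : ∀ v ∈ V, Integrable (fun ω ↦ F ε v ω + F (-ε) v ω) P := fun v hv ↦
    (hF_integrable ε (by linarith) v hv).add (hF_integrable (-ε) (by linarith) v hv)
  obtain ⟨ω, hω⟩ := exists_le_integral (integrable_finsetSum V hF_integrable_add)
  have hsum : ∑ v ∈ V, (F ε v ω + F (-ε) v ω) < 1 := by
    refine hω.trans_lt (lt_of_le_of_lt ?_ hV)
    rw [integral_finsetSum V hF_integrable_add]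
    have h : ∀ v ∈ V, ∫ ω, (F ε v ω + F (-ε) v ω) ∂P
        ≤ 2 * exp (-(m / 2 * (ε ^ 2 / 2 - ε ^ 3 / 3))) := by
      intro v hv
      rw [integral_add (hF_integrable ε (by linarith) v hv)
        (hF_integrable (-ε) (by linarith) v hv), two_mul]
      refine add_le_add (hbound ε (by linarith) le_rfl v hv)
        (hbound (-ε) (by linarith) ?_ v hv)
      have : 0 < ε ^ 3 := by positivity
      nlinarith
    refine (sum_le_sum h).trans_eq ?_
    rw [sum_const, nsmul_eq_mul]
    ring
  have hdev : ∀ s, -1 < s → ∀ v ∈ V, F s v ω < 1 →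
      s * ‖scaledInnerMap ω v‖ ^ 2 ≤ s * ((1 + s) * ‖v‖ ^ 2) := by
    intro s hs v hv hF
    have hs' : 0 < 1 + s := by linarith
    have hv' : 0 < ‖v‖ := norm_pos_iff.2 (hV0 v hv)
    have h := exp_lt_one_iff.1 hF
    have hm : 0 < (m : ℝ) := by
      rcases Nat.eq_zero_or_pos m with rfl | hm
      · simp at h
      · exact_mod_cast hm
    simp only [real_inner_smul_left, mul_pow, sum_sub_distrib, ← mul_sum, sum_const, card_univ,
      Fintype.card_fin, nsmul_eq_mul] at h
    rw [norm_sq_scaledInnerMap]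
    set q := ∑ k, ⟪v, ω k⟫ ^ 2
    have h' : s / (2 * (1 + s)) * (‖v‖⁻¹ ^ 2 * q) ≤ m * (s / 2) := by linarith
    calc s * (q / m)
        = s / (2 * (1 + s)) * (‖v‖⁻¹ ^ 2 * q) * (2 * (1 + s) * ‖v‖ ^ 2 / m) := by field_simp
      _ ≤ m * (s / 2) * (2 * (1 + s) * ‖v‖ ^ 2 / m) := by gcongr
      _ = s * ((1 + s) * ‖v‖ ^ 2) := by field_simp
  refine ⟨scaledInnerMap ω, fun v hv ↦ ?_⟩
  have hFpos : ∀ s v, 0 < F s v ω := fun s v ↦ exp_pos _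
  have hle : F ε v ω + F (-ε) v ω < 1 :=
    (single_le_sum (f := fun v ↦ F ε v ω + F (-ε) v ω)
      (fun w _ ↦ (add_pos (hFpos ε w) (hFpos (-ε) w)).le) hv).trans_lt hsum
  constructor
  · have := hdev (-ε) (by linarith) v hv (by linarith [hFpos ε v])
    refine le_of_mul_le_mul_left ?_ hε0
    linarith
  · exact le_of_mul_le_mul_left (hdev ε (by linarith) v hv (by linarith [hFpos (-ε) v])) hε0

end GaussianMatrix

lemma card_filter_fin_lt_mul_two (N : ℕ) :
    #{p : Fin N × Fin N | p.1 < p.2} * 2 = N * (N - 1) := by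
  have h : #{p : Fin N × Fin N | p.1 < p.2} = ∑ j : Fin N, (j : ℕ) := by
    rw [card_filter, Fintype.sum_prod_type_right]
    refine sum_congr rfl fun j _ ↦ ?_
    rw [← card_filter, filter_gt_eq_Iio, Fin.card_Iio]
  rw [h, Fin.sum_univ_eq_sum_range (fun j ↦ j), sum_range_id_mul_two]


/-- **Johnson–Lindenstrauss lemma.** Let `0 < ε < 1` and let `m, N, n` be natural numbers
with `m ≥ 4(ε²/2 - ε³/3)⁻¹ ln N`. Then for every set of points `x¹, …, x^N ∈ ℝⁿ` there is a
linear map `f : ℝⁿ → ℝ^m` with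
`(1-ε)‖xⁱ - xʲ‖² ≤ ‖f(xⁱ) - f(xʲ)‖² ≤ (1+ε)‖xⁱ - xʲ‖²` for all `i, j`. -/
theorem johnson_lindenstrauss (ε : ℝ) (hε0 : 0 < ε) (hε1 : ε < 1) (m N n : ℕ)
    (hm : (m : ℝ) ≥ 4 * (ε ^ 2 / 2 - ε ^ 3 / 3)⁻¹ * Real.log N)
    (x : Fin N → EuclideanSpace ℝ (Fin n)) :
    ∃ f : EuclideanSpace ℝ (Fin n) →ₗ[ℝ] EuclideanSpace ℝ (Fin m),
      ∀ i j, (1 - ε) * ‖x i - x j‖ ^ 2 ≤ ‖f (x i) - f (x j)‖ ^ 2 ∧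
        ‖f (x i) - f (x j)‖ ^ 2 ≤ (1 + ε) * ‖x i - x j‖ ^ 2 := by
  classical
  let d : Fin N × Fin N → EuclideanSpace ℝ (Fin n) := fun p ↦ x p.1 - x p.2
  let A : Finset (Fin N × Fin N) := {p | p.1 < p.2}
  let V := (A.image d).erase 0
  have hc : 0 < ε ^ 2 / 2 - ε ^ 3 / 3 := by
    have : 0 < ε ^ 2 := by positivity
    nlinarith
  have hcard : 2 * #V * exp (-(m / 2 * (ε ^ 2 / 2 - ε ^ 3 / 3))) < 1 := by
    rcases Nat.eq_zero_or_pos N with rfl | hN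
    · have : V = ∅ := by simp [V, A]
      simp [this]
    have hN' : (0 : ℝ) < N := by exact_mod_cast hN
    have hVA : #V * 2 ≤ N * (N - 1) := by
      rw [← card_filter_fin_lt_mul_two N]
      exact Nat.mul_le_mul_right 2 ((card_erase_le).trans card_image_le)
    have hVA' : 2 * (#V : ℝ) ≤ N * (N - 1) := by
      have : ((#V * 2 : ℕ) : ℝ) ≤ (N * (N - 1) : ℕ) := by exact_mod_cast hVA
      push_cast [Nat.cast_sub (show 1 ≤ N from hN)] at this
      linarith
    have hexp : exp (-(m / 2 * (ε ^ 2 / 2 - ε ^ 3 / 3))) ≤ ((N : ℝ) ^ 2)⁻¹ := by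
      rw [← exp_log (show (0 : ℝ) < ((N : ℝ) ^ 2)⁻¹ by positivity), log_inv, log_pow, exp_le_exp]
      have h : 4 * (ε ^ 2 / 2 - ε ^ 3 / 3)⁻¹ * log N * (ε ^ 2 / 2 - ε ^ 3 / 3)
          ≤ m * (ε ^ 2 / 2 - ε ^ 3 / 3) := by gcongr
      have h' : 4 * (ε ^ 2 / 2 - ε ^ 3 / 3)⁻¹ * log N * (ε ^ 2 / 2 - ε ^ 3 / 3) = 4 * log N := by
        rw [mul_right_comm, inv_mul_cancel_right₀ hc.ne']
      push_cast
      linarith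
    calc 2 * #V * exp (-(m / 2 * (ε ^ 2 / 2 - ε ^ 3 / 3)))
        ≤ 2 * #V * ((N : ℝ) ^ 2)⁻¹ := by gcongr
      _ ≤ N * (N - 1) * ((N : ℝ) ^ 2)⁻¹ := by gcongr
      _ < 1 := by
        rw [← div_eq_mul_inv, div_lt_one (by positivity)]
        nlinarith
  obtain ⟨f, hf⟩ := exists_linearMap_norm_sq_bounds hε0 hε1 m V
    (fun v hv ↦ ne_of_mem_erase hv) hcard
  have hlt : ∀ i j, i < j → (1 - ε) * ‖x i - x j‖ ^ 2 ≤ ‖f (x i) - f (x j)‖ ^ 2 ∧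
      ‖f (x i) - f (x j)‖ ^ 2 ≤ (1 + ε) * ‖x i - x j‖ ^ 2 := by
    intro i j hij
    rw [← map_sub]
    by_cases h : x i - x j = 0
    · simp [h]
    · exact hf _ (mem_erase.2 ⟨h, mem_image.2 ⟨(i, j), by simpa [A] using hij, rfl⟩⟩)
  refine ⟨f, fun i j ↦ ?_⟩
  rcases lt_trichotomy i j with h | rfl | h
  · exact hlt i j h
  · simp
  · rw [norm_sub_rev (x i), norm_sub_rev (f (x i))]
    exact hlt j i h
end

section
/- Let A, B ∈ ℝ^{d×d} be two symmetric matrices and let λ₁(M) ≥ λ₂(M) ≥ … ≥ λ_d(M) denote the eigenvalues of a symmetric matrix M arranged in nonincreasing order. Then ∑_{j=1}^d |λ_j(A) − λ_j(B)| ≤ ∑_{j=1}^d |λ_j(A−B)|. -/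
open Matrix

/-- The rearrangement of a finite tuple of reals in nonincreasing order. -/
noncomputable def sortedDesc {d : ℕ} (f : Fin d → ℝ) : Fin d → ℝ :=
  fun j => -(((fun i => -f i) ∘ (Tuple.sort fun i => -f i)) j)

/-- A symmetric operator is diagonal, as a quadratic form, in an orthonormal eigenbasis. -/
lemma inner_apply_self_eq_sum_of_eigenbasis {ι E : Type*} [Fintype ι] [NormedAddCommGroup E]
    [InnerProductSpace ℝ E] {T : E →ₗ[ℝ] E} (hT : T.IsSymmetric) (v : OrthonormalBasis ι ℝ E)
    {a : ι → ℝ} (hv : ∀ i, T (v i) = a i • v i) (x : E) :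
    inner ℝ x (T x) = ∑ i, a i * inner ℝ (v i) x ^ 2 := by
  rw [← v.sum_inner_mul_inner x (T x)]
  refine Finset.sum_congr rfl fun i _ => ?_
  rw [← hT, hv, real_inner_smul_left, real_inner_comm]
  ring

/-- Weyl monotonicity: if `T ≤ S` as quadratic forms, then the eigenvalues of `T`, listed in
nonincreasing order, are bounded by those of `S`. -/
lemma eigenvalue_le_of_inner_le {ι E : Type*} [Fintype ι] [LinearOrder ι] [NormedAddCommGroup E]
    [InnerProductSpace ℝ E] {T S : E →ₗ[ℝ] E} (hT : T.IsSymmetric) (hS : S.IsSymmetric)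
    (hTS : ∀ x, inner ℝ x (T x) ≤ inner ℝ x (S x)) (v w : OrthonormalBasis ι ℝ E)
    {a b : ι → ℝ} (hv : ∀ i, T (v i) = a i • v i) (hw : ∀ i, S (w i) = b i • w i)
    (ha : Antitone a) (hb : Antitone b) (j : ι) : a j ≤ b j := by
  let F : E →ₗ[ℝ] ({i // i ≠ j} → ℝ) :=
    LinearMap.pi fun i => if j < i then innerₛₗ ℝ (v i) else innerₛₗ ℝ (w i)
  have : FiniteDimensional ℝ E := v.toBasis.finiteDimensional_of_finite
  have hF : LinearMap.ker F ≠ ⊥ := by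
    apply LinearMap.ker_ne_bot_of_finrank_lt
    rw [Module.finrank_eq_card_basis v.toBasis, Module.finrank_fintype_fun_eq_card]
    exact Fintype.card_subtype_lt (x := j) (by simp)
  obtain ⟨x, hx, hx0⟩ := Submodule.exists_mem_ne_zero_of_ne_bot hF
  have hxv : ∀ i, j < i → inner ℝ (v i) x = 0 := fun i hi => by
    simpa [F, hi] using congrFun (LinearMap.mem_ker.1 hx) ⟨i, hi.ne'⟩
  have hxw : ∀ i, i < j → inner ℝ (w i) x = 0 := fun i hi => by
    simpa [F, hi.not_gt] using congrFun (LinearMap.mem_ker.1 hx) ⟨i, hi.ne⟩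
  have hlow : a j * ‖x‖ ^ 2 ≤ inner ℝ x (T x) := by
    rw [inner_apply_self_eq_sum_of_eigenbasis hT v hv, ← v.sum_sq_inner_right, Finset.mul_sum]
    refine Finset.sum_le_sum fun i _ => ?_
    rcases lt_or_ge j i with h | h
    · simp [hxv i h]
    · exact mul_le_mul_of_nonneg_right (ha h) (sq_nonneg _)
  have hupp : inner ℝ x (S x) ≤ b j * ‖x‖ ^ 2 := by
    rw [inner_apply_self_eq_sum_of_eigenbasis hS w hw, ← w.sum_sq_inner_right, Finset.mul_sum]
    refine Finset.sum_le_sum fun i _ => ?_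
    rcases lt_or_ge i j with h | h
    · simp [hxw i h]
    · exact mul_le_mul_of_nonneg_right (hb h) (sq_nonneg _)
  exact le_of_mul_le_mul_right (hlow.trans ((hTS x).trans hupp)) (by positivity)

lemma sortedDesc_apply {d : ℕ} (f : Fin d → ℝ) (j : Fin d) :
    sortedDesc f j = f (Tuple.sort (fun i => -f i) j) := by
  simp [sortedDesc]

lemma sortedDesc_antitone {d : ℕ} (f : Fin d → ℝ) : Antitone (sortedDesc f) :=
  fun _ _ h => neg_le_neg (Tuple.monotone_sort (fun i => -f i) h)

lemma sum_comp_sortedDesc {d : ℕ} (g : ℝ → ℝ) (f : Fin d → ℝ) :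
    ∑ j, g (sortedDesc f j) = ∑ j, g (f j) := by
  simp_rw [sortedDesc_apply]
  exact Equiv.sum_comp (Tuple.sort fun i => -f i) fun i => g (f i)

lemma sum_sortedDesc_eigenvalues {d : ℕ} {A : Matrix (Fin d) (Fin d) ℝ} (hA : A.IsHermitian) :
    ∑ j, sortedDesc hA.eigenvalues j = A.trace := by
  rw [hA.trace_eq_sum_eigenvalues]
  exact sum_comp_sortedDesc id _

lemma sortedDesc_eigenvalues_le {d : ℕ} {A B : Matrix (Fin d) (Fin d) ℝ}
    (hA : A.IsHermitian) (hB : B.IsHermitian) (h : (B - A).PosSemidef) (j : Fin d) :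
    sortedDesc hA.eigenvalues j ≤ sortedDesc hB.eigenvalues j := by
  have hbasis : ∀ {M : Matrix (Fin d) (Fin d) ℝ} (hM : M.IsHermitian) (i : Fin d),
      toEuclideanLin M
          (hM.eigenvectorBasis.reindex (Tuple.sort fun i => -hM.eigenvalues i).symm i) =
        sortedDesc hM.eigenvalues i •
          hM.eigenvectorBasis.reindex (Tuple.sort fun i => -hM.eigenvalues i).symm i := by
    intro M hM i
    ext k
    simpa [sortedDesc_apply, toLpLin_apply] using congrFun (hM.mulVec_eigenvectorBasis _) k
  refine eigenvalue_le_of_inner_le (isSymmetric_toEuclideanLin_iff.mpr hA)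
    (isSymmetric_toEuclideanLin_iff.mpr hB) (fun x => ?_) _ _ (hbasis hA) (hbasis hB)
    (sortedDesc_antitone _) (sortedDesc_antitone _) j
  have := h.dotProduct_mulVec_nonneg x.ofLp
  simp only [star_trivial, sub_mulVec, dotProduct_sub] at this
  simp only [EuclideanSpace.inner_eq_star_dotProduct, toLpLin_apply, star_trivial]
  rw [dotProduct_comm, dotProduct_comm (B *ᵥ _)]
  linarith

/-- The Jordan decomposition of a symmetric matrix, with the traces of the two parts adding up to
the nuclear norm. -/
lemma Matrix.IsHermitian.exists_posSemidef_sub {d : ℕ} {C : Matrix (Fin d) (Fin d) ℝ}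
    (hC : C.IsHermitian) :
    ∃ P N : Matrix (Fin d) (Fin d) ℝ, P.PosSemidef ∧ N.PosSemidef ∧ C = P - N ∧
      P.trace + N.trace = ∑ j, |hC.eigenvalues j| := by
  let U : Matrix (Fin d) (Fin d) ℝ := hC.eigenvectorUnitary
  have htr : ∀ D : Matrix (Fin d) (Fin d) ℝ, (U * D * Uᴴ).trace = D.trace := fun D => by
    have hU : Uᴴ * U = 1 := Unitary.coe_star_mul_self hC.eigenvectorUnitary
    rw [trace_mul_comm, ← mul_assoc, hU, one_mul]
  refine ⟨U * diagonal (fun i => (hC.eigenvalues i)⁺) * Uᴴ,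
    U * diagonal (fun i => (hC.eigenvalues i)⁻) * Uᴴ,
    (PosSemidef.diagonal fun i => posPart_nonneg _).mul_mul_conjTranspose_same U,
    (PosSemidef.diagonal fun i => negPart_nonneg _).mul_mul_conjTranspose_same U, ?_, ?_⟩
  · rw [← sub_mul, ← mul_sub, diagonal_sub]
    simp_rw [posPart_sub_negPart]
    exact hC.spectral_theorem
  · rw [htr, htr, trace_diagonal, trace_diagonal, ← Finset.sum_add_distrib]
    simp_rw [posPart_add_negPart]

/-- **Lidskii-type inequality for eigenvalues.** For real symmetric `d × d` matrices
`A`, `B`, with eigenvalues `λ₁ ≥ … ≥ λ_d` arranged in nonincreasing order,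
`∑_j |λ_j(A) - λ_j(B)| ≤ ∑_j |λ_j(A-B)|`. -/
theorem eigenvalues_lidskii {d : ℕ} {A B : Matrix (Fin d) (Fin d) ℝ}
    (hA : A.IsHermitian) (hB : B.IsHermitian) :
    ∑ j, |sortedDesc hA.eigenvalues j - sortedDesc hB.eigenvalues j|
      ≤ ∑ j, |sortedDesc (hA.sub hB).eigenvalues j| := by
  obtain ⟨P, N, hP, hN, hsub, htr⟩ := (hA.sub hB).exists_posSemidef_sub
  have hM : (A + N).IsHermitian := hA.add hN.isHermitian
  have hMB : A + N - B = P := by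
    rw [add_sub_right_comm, hsub, sub_add_cancel]
  have hAM := sortedDesc_eigenvalues_le hA hM (by simpa using hN)
  have hBM := sortedDesc_eigenvalues_le hB hM (hMB ▸ hP)
  calc ∑ j, |sortedDesc hA.eigenvalues j - sortedDesc hB.eigenvalues j|
      ≤ ∑ j, ((sortedDesc hM.eigenvalues j - sortedDesc hB.eigenvalues j) +
          (sortedDesc hM.eigenvalues j - sortedDesc hA.eigenvalues j)) :=
        Finset.sum_le_sum fun j _ => abs_le.2 ⟨by linarith [hAM j, hBM j],
          by linarith [hAM j, hBM j]⟩
    _ = (A + N - B).trace + (A + N - A).trace := by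
        simp only [Finset.sum_add_distrib, Finset.sum_sub_distrib, sum_sortedDesc_eigenvalues,
          trace_sub]
    _ = ∑ j, |sortedDesc (hA.sub hB).eigenvalues j| := by
        rw [hMB, add_sub_cancel_left, htr, sum_comp_sortedDesc]
end

section
/- Let 𝒳 : ℝ^{n×N} → ℝ^m be a linear map with n ≤ N and let 1 ≤ r ≤ n/2. Suppose there exists 0 ≤ δ < 1/3 such that (1−δ)‖A‖_F² ≤ ‖𝒳(A)‖₂² ≤ (1+δ)‖A‖_F² for all matrices A ∈ ℝ^{n×N} with rank(A) ≤ 2r. Then 𝒳 satisfies the rank-r null space property: ∑_{j=1}^r σ_j(M) < ∑_{j=r+1}^n σ_j(M) for every nonzero M in the kernel of 𝒳. In particular, every A ∈ ℝ^{n×N} with rank(A) ≤ r is the unique minimizer of ‖Z‖_* subject to 𝒳(Z) = 𝒳(A). -/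
open Matrix

/-- The singular values `σ₁(A) ≥ σ₂(A) ≥ … ≥ σ_n(A) ≥ 0` of a real `n × N` matrix,
in nonincreasing order: the square roots of the eigenvalues of `A * Aᵀ`. -/
noncomputable def singularValues {n N : ℕ} (A : Matrix (Fin n) (Fin N) ℝ) : Fin n → ℝ :=
  sortedDesc fun j => Real.sqrt ((Matrix.isHermitian_mul_conjTranspose_self A).eigenvalues j)

theorem sum_head_lt_sum_tail_of_RIP {n m r : ℕ} (hr : 1 ≤ r) {s : Fin n → ℝ} (hs : Antitone s)
    (hs0 : ∀ j, 0 ≤ s j) (hne : s ≠ 0) (L : (Fin n → ℝ) →ₗ[ℝ] (Fin m → ℝ)) {δ : ℝ}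
    (hδ0 : 0 ≤ δ) (hδ : δ < 1 / 3)
    (hL : ∀ d : Fin n → ℝ, (Finset.univ.filter fun j => d j ≠ 0).card ≤ 2 * r →
      (1 - δ) * ∑ j, (d j * s j) ^ 2 ≤ L d ⬝ᵥ L d ∧
        L d ⬝ᵥ L d ≤ (1 + δ) * ∑ j, (d j * s j) ^ 2)
    (hL1 : L 1 = 0) :
    ∑ j ∈ Finset.univ.filter (fun j : Fin n => (j : ℕ) < r), s j
      < ∑ j ∈ Finset.univ.filter (fun j : Fin n => r ≤ (j : ℕ)), s j := by
  classical
  set blk : ℕ → Finset (Fin n) := fun k => Finset.univ.filter fun j => (j : ℕ) / r = k with hblk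
  set e : ℕ → Fin n → ℝ := fun k j => if (j : ℕ) / r = k then 1 else 0 with he
  set q : ℕ → ℝ := fun k => √(∑ j ∈ blk k, s j ^ 2) with hq
  set b : ℕ → ℝ := fun k => ∑ j ∈ blk k, s j with hb
  have hqsq : ∀ k, q k ^ 2 = ∑ j ∈ blk k, s j ^ 2 := fun k =>
    Real.sq_sqrt (Finset.sum_nonneg fun j _ => sq_nonneg _)
  have hq0 : ∀ k, 0 ≤ q k := fun k => Real.sqrt_nonneg _
  have hb0 : ∀ k, 0 ≤ b k := fun k => Finset.sum_nonneg fun j _ => hs0 j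
  have hcard_ico : ∀ k, (blk k).card = (Finset.filter (· / r = k) (Finset.range n)).card := by
    intro k
    rw [Finset.card_filter, Finset.card_filter]
    exact Fin.sum_univ_eq_sum_range (fun j => if j / r = k then 1 else 0) n
  have hdiv : ∀ j k : ℕ, j / r = k ↔ k * r ≤ j ∧ j < k * r + r := by
    intro j k
    rw [Nat.div_eq_iff hr]
    have : 1 ≤ k * r + r := by omega
    omega
  have hcard : ∀ k, (blk k).card ≤ r := by
    intro k
    rw [hcard_ico]
    calc _ ≤ (Finset.Ico (k * r) (k * r + r)).card := by
          refine Finset.card_le_card fun j hj => ?_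
          simp only [Finset.mem_filter, hdiv] at hj
          simpa using hj.2
      _ = r := by simp
  have hcard_full : ∀ k, k * r + r ≤ n → (blk k).card = r := by
    intro k hk
    rw [hcard_ico]
    have : Finset.filter (· / r = k) (Finset.range n) = Finset.Ico (k * r) (k * r + r) := by
      ext j
      simp only [Finset.mem_filter, hdiv, Finset.mem_range, Finset.mem_Ico]
      omega
    simp [this]
  have hr0 : (0 : ℝ) < r := by exact_mod_cast hr
  have hshift : ∀ k, r * q (k + 1) ^ 2 ≤ b k ^ 2 := by
    intro k
    have h1 : ∀ j ∈ blk (k + 1), s j ≤ b k / r := by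
      intro j hj
      have hj' := (hdiv j (k + 1)).1 (by simpa [hblk] using hj)
      have hk : (k + 1) * r = k * r + r := by ring
      rw [le_div_iff₀ hr0, mul_comm]
      have h2 := Finset.card_nsmul_le_sum (blk k) s (s j) (fun i hi => hs (by
        have hi' := (hdiv i k).1 (by simpa [hblk] using hi)
        rw [Fin.le_def]; omega))
      rwa [hcard_full k (by omega), nsmul_eq_mul] at h2
    rw [hqsq]
    calc (r : ℝ) * ∑ j ∈ blk (k + 1), s j ^ 2 ≤ r * (r * (b k / r) ^ 2) := by
          gcongr
          calc ∑ j ∈ blk (k + 1), s j ^ 2 ≤ (blk (k + 1)).card • (b k / r) ^ 2 :=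
                Finset.sum_le_card_nsmul _ _ _ fun j hj => by
                  have := hs0 j; have := h1 j hj; gcongr
            _ ≤ r * (b k / r) ^ 2 := by
                rw [nsmul_eq_mul]
                gcongr
                exact_mod_cast hcard _
      _ = b k ^ 2 := by field_simp
  have hshift' : ∀ k, √r * q (k + 1) ≤ b k := fun k => by
    refine le_of_sq_le_sq ?_ (hb0 k)
    rw [mul_pow, Real.sq_sqrt hr0.le]
    exact hshift k
  have hhead : b 0 ≤ √r * q 0 := by
    refine le_of_sq_le_sq ?_ (mul_nonneg (Real.sqrt_nonneg _) (hq0 0))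
    rw [mul_pow, Real.sq_sqrt hr0.le, hqsq]
    refine (sq_sum_le_card_mul_sum_sq (s := blk 0) (f := s)).trans ?_
    gcongr
    exact_mod_cast hcard 0
  have hdot : ∀ (k : ℕ) (α β : ℝ), L (α • e 0 + β • e (k + 1)) ⬝ᵥ L (α • e 0 + β • e (k + 1)) =
      α ^ 2 * (L (e 0) ⬝ᵥ L (e 0)) + 2 * α * β * (L (e 0) ⬝ᵥ L (e (k + 1)))
        + β ^ 2 * (L (e (k + 1)) ⬝ᵥ L (e (k + 1))) := by
    intro k α β
    simp only [map_add, map_smul, add_dotProduct, dotProduct_add, smul_dotProduct,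
      dotProduct_smul, smul_eq_mul]
    rw [dotProduct_comm (L (e (k + 1))) (L (e 0))]
    ring
  have hnorm : ∀ (k : ℕ) (α β : ℝ), ∑ j, ((α • e 0 + β • e (k + 1)) j * s j) ^ 2 =
      α ^ 2 * q 0 ^ 2 + β ^ 2 * q (k + 1) ^ 2 := by
    intro k α β
    simp only [hqsq, hblk, Finset.mul_sum, Finset.sum_filter, ← Finset.sum_add_distrib]
    refine Finset.sum_congr rfl fun j _ => ?_
    simp only [he, Pi.add_apply, Pi.smul_apply, smul_eq_mul]
    split_ifs with h1 h2 h2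
    · omega
    all_goals ring
  have hsupp : ∀ (k : ℕ) (α β : ℝ),
      (Finset.univ.filter fun j => (α • e 0 + β • e (k + 1)) j ≠ 0).card ≤ 2 * r := by
    intro k α β
    calc _ ≤ (blk 0 ∪ blk (k + 1)).card := by
          refine Finset.card_le_card fun j hj => ?_
          simp only [Finset.mem_filter, Finset.mem_univ, true_and, he, Pi.add_apply,
            Pi.smul_apply, smul_eq_mul] at hj
          simp only [hblk, Finset.mem_union, Finset.mem_filter, Finset.mem_univ, true_and]
          by_contra hcon
          rw [not_or] at hcon
          simp [hcon.1, hcon.2] at hj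
      _ ≤ (blk 0).card + (blk (k + 1)).card := Finset.card_union_le _ _
      _ ≤ 2 * r := by have := hcard 0; have := hcard (k + 1); omega
  have hRIP : ∀ (k : ℕ) (α β : ℝ), _ := fun k α β => hL _ (hsupp k α β)
  simp only [hdot, hnorm] at hRIP
  have hcross : ∀ k, -(L (e 0) ⬝ᵥ L (e (k + 1))) ≤ δ * q 0 * q (k + 1) := by
    intro k
    set p := L (e 0) ⬝ᵥ L (e (k + 1)) with hp
    rcases (hq0 (k + 1)).eq_or_lt with h | h
    · have h1 := (hRIP k 0 1).2
      rw [← h] at h1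
      have h2 : L (e (k + 1)) = 0 := by
        rw [← dotProduct_self_eq_zero (R := ℝ)]
        refine le_antisymm (by linarith) ?_
        exact Finset.sum_nonneg fun i _ => mul_self_nonneg _
      rw [hp, h2, ← h]; simp
    rcases (hq0 0).eq_or_lt with h' | h'
    · have h1 := (hRIP k 1 0).2
      rw [← h'] at h1
      have h2 : L (e 0) = 0 := by
        rw [← dotProduct_self_eq_zero (R := ℝ)]
        refine le_antisymm (by linarith) ?_
        exact Finset.sum_nonneg fun i _ => mul_self_nonneg _
      rw [hp, h2, ← h']; simp
    have h1 := (hRIP k (q (k + 1)) (q 0)).1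
    have h2 := (hRIP k (q (k + 1)) (-q 0)).2
    have h3 : 0 < q 0 * q (k + 1) := mul_pos h' h
    refine le_of_mul_le_mul_left ?_ h3
    nlinarith
  have hsum_e : ∑ k ∈ Finset.range (n + 1), e k = 1 := by
    ext j
    have : (j : ℕ) / r < n + 1 := (Nat.div_le_self _ _).trans_lt (by omega)
    simp [he, Finset.sum_apply, this]
  have hmain : (1 - δ) * q 0 ^ 2 ≤ δ * q 0 * ∑ k ∈ Finset.range n, q (k + 1) := by
    have h1 := (hRIP 0 1 0).1
    have h2 : L (e 0) ⬝ᵥ L (e 0) = ∑ k ∈ Finset.range n, -(L (e 0) ⬝ᵥ L (e (k + 1))) := by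
      have h3 : L (e 0) ⬝ᵥ L (∑ k ∈ Finset.range (n + 1), e k) = 0 := by
        rw [hsum_e, hL1, dotProduct_zero]
      rw [Finset.sum_range_succ', map_add, map_sum, dotProduct_add, dotProduct_sum] at h3
      rw [Finset.sum_neg_distrib]
      linarith
    calc (1 - δ) * q 0 ^ 2 ≤ L (e 0) ⬝ᵥ L (e 0) := by linarith
      _ ≤ ∑ k ∈ Finset.range n, δ * q 0 * q (k + 1) := by
          rw [h2]; exact Finset.sum_le_sum fun k _ => hcross k
      _ = _ := by rw [Finset.mul_sum]
  have hpos : 0 < b 0 := by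
    obtain ⟨j, hj⟩ := Function.ne_iff.1 hne
    have hn : 0 < n := j.pos
    have h1 : 0 < s ⟨0, hn⟩ :=
      ((hs0 j).lt_of_ne (Ne.symm hj)).trans_le (hs (by rw [Fin.le_def]; simp))
    refine Finset.sum_pos' (fun i _ => hs0 i) ⟨⟨0, hn⟩, by simp [hblk]; omega, h1⟩
  have hq0pos : 0 < q 0 := by
    by_contra h
    have : q 0 = 0 := le_antisymm (not_lt.1 h) (hq0 0)
    rw [this] at hhead
    simp at hhead
    linarith
  have hmain' : (1 - δ) * b 0 ≤ δ * ∑ k ∈ Finset.range n, b k := by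
    have h1 : (1 - δ) * q 0 ≤ δ * ∑ k ∈ Finset.range n, q (k + 1) := by
      refine le_of_mul_le_mul_left ?_ hq0pos
      nlinarith
    calc (1 - δ) * b 0 ≤ (1 - δ) * (√r * q 0) := by gcongr; linarith
      _ = √r * ((1 - δ) * q 0) := by ring
      _ ≤ √r * (δ * ∑ k ∈ Finset.range n, q (k + 1)) := by gcongr
      _ = δ * ∑ k ∈ Finset.range n, √r * q (k + 1) := by rw [← Finset.mul_sum]; ring
      _ ≤ _ := by gcongr with k _; exact hshift' k
  have htotal : ∑ k ∈ Finset.range n, b k = ∑ j, s j :=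
    Finset.sum_fiberwise_of_maps_to (fun j _ => Finset.mem_range.2
      ((Nat.div_le_self _ _).trans_lt j.2)) s
  have hb_head : b 0 = ∑ j ∈ Finset.univ.filter (fun j : Fin n => (j : ℕ) < r), s j := by
    simp only [hb, hblk]
    congr 1
    ext j
    simp only [Finset.mem_filter, Finset.mem_univ, true_and, Nat.div_eq_zero_iff]
    omega
  have hsplit := Finset.sum_filter_add_sum_filter_not Finset.univ (fun j : Fin n => (j : ℕ) < r) s
  simp only [not_lt] at hsplit
  rw [htotal, ← hsplit, ← hb_head] at hmain'
  rw [← hb_head]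
  by_contra! hcon
  nlinarith

theorem Matrix.rank_mul_diagonal_mul_le {k l n : ℕ} (P : Matrix (Fin k) (Fin n) ℝ)
    (d : Fin n → ℝ) (Q : Matrix (Fin n) (Fin l) ℝ) :
    (P * diagonal d * Q).rank ≤ (Finset.univ.filter fun j => d j ≠ 0).card := by
  classical
  calc (P * diagonal d * Q).rank ≤ (diagonal d).rank :=
        (rank_mul_le_left _ _).trans (rank_mul_le_right _ _)
    _ = _ := by rw [rank_diagonal, Fintype.card_subtype]

/-- A lower bound for the `i`-th largest eigenvalue from a subspace of dimension more than `i`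
on which the quadratic form is bounded below. -/
theorem LinearMap.IsSymmetric.le_eigenvalues_of_lt_finrank {E : Type*} [NormedAddCommGroup E]
    [InnerProductSpace ℝ E] [FiniteDimensional ℝ E] {d : ℕ} {T : E →ₗ[ℝ] E} (hT : T.IsSymmetric)
    (hd : Module.finrank ℝ E = d) (i : Fin d) (c : ℝ) (V : Submodule ℝ E)
    (hV : (i : ℕ) < Module.finrank ℝ V) (h : ∀ x ∈ V, c * ‖x‖ ^ 2 ≤ inner ℝ x (T x)) :
    c ≤ hT.eigenvalues hd i := by
  set b := hT.eigenvectorBasis hd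
  let f : V →ₗ[ℝ] (Fin i → ℝ) :=
    LinearMap.pi fun k => (innerₛₗ ℝ (b ⟨k, k.2.trans i.2⟩)) ∘ₗ V.subtype
  have hf : LinearMap.ker f ≠ ⊥ := LinearMap.ker_ne_bot_of_finrank_lt (by simpa using hV)
  obtain ⟨⟨x, hxV⟩, hx, hx0⟩ := Submodule.exists_mem_ne_zero_of_ne_bot hf
  have hx0' : x ≠ 0 := fun h => hx0 (by simp [h])
  have hperp : ∀ k : Fin d, k < i → inner ℝ (b k) x = 0 := fun k hk => by
    have := congrFun (LinearMap.mem_ker.1 hx) ⟨k, hk⟩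
    simpa [f] using this
  have hpos : 0 < ‖x‖ ^ 2 := by positivity
  refine le_of_mul_le_mul_right ((h x hxV).trans ?_) hpos
  rw [← b.sum_inner_mul_inner x (T x), ← b.sum_sq_norm_inner_right x, Finset.mul_sum]
  refine Finset.sum_le_sum fun k _ => ?_
  have h1 : inner ℝ (b k) (T x) = hT.eigenvalues hd k * inner ℝ (b k) x := by
    rw [← hT, hT.apply_eigenvectorBasis]
    simp [inner_smul_left, b]
  rw [h1, Real.norm_eq_abs, sq_abs, real_inner_comm]
  rcases lt_or_ge k i with hk | hk
  · simp [hperp k hk]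
  · have := hT.eigenvalues_antitone hd hk
    nlinarith [sq_nonneg (inner ℝ (b k) x)]

theorem Matrix.IsHermitian.sum_le_trace_of_forall_lt_finrank {ι : Type*} [Fintype ι]
    [DecidableEq ι] {R : Matrix ι ι ℝ} (hR : R.IsHermitian) {d : ℕ} (hd : Fintype.card ι = d)
    (c : Fin d → ℝ)
    (h : ∀ i : Fin d, ∃ V : Submodule ℝ (ι → ℝ), (i : ℕ) < Module.finrank ℝ V ∧
      ∀ x ∈ V, c i * (x ⬝ᵥ x) ≤ x ⬝ᵥ R *ᵥ x) :
    ∑ i, c i ≤ R.trace := by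
  have hT := isSymmetric_toEuclideanLin_iff.mpr hR
  have hd' : Module.finrank ℝ (EuclideanSpace ℝ ι) = d := by simp [hd]
  have htr : R.trace = ∑ i, hT.eigenvalues hd' i := by
    have h1 : LinearMap.trace ℝ _ R.toEuclideanLin = R.trace := by
      exact (congrArg _ (congrFun (congrArg _ (toLpLin_eq_toLin 2 2)) R)).trans (trace_toLin_eq _ _)
    rw [← h1]
    exact hT.trace_eq_sum_eigenvalues hd'
  rw [htr]
  refine Finset.sum_le_sum fun i _ => ?_
  obtain ⟨V, hV, hVR⟩ := h i
  let e := (WithLp.linearEquiv 2 ℝ (ι → ℝ)).symm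
  refine hT.le_eigenvalues_of_lt_finrank hd' i (c i) (V.map e.toLinearMap) ?_ ?_
  · rwa [LinearEquiv.finrank_map_eq]
  · rintro _ ⟨x, hx, rfl⟩
    have h1 := hVR x hx
    have h2 : ‖e x‖ ^ 2 = x ⬝ᵥ x := by
      rw [EuclideanSpace.real_norm_sq_eq]
      simp [e, dotProduct, sq]
    have h3 : inner ℝ (e x) (R.toEuclideanLin (e x)) = x ⬝ᵥ R *ᵥ x := by
      simp [e, EuclideanSpace.inner_eq_star_dotProduct, toLpLin_apply, dotProduct_comm]
    rw [LinearEquiv.coe_coe, h2, h3]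
    exact h1

/-- `U` is orthogonal, and its rows are left singular vectors of `A` for the nonincreasing
singular values `s`. -/
structure Matrix.IsLeftSingular {n N : ℕ} (A : Matrix (Fin n) (Fin N) ℝ)
    (U : Matrix (Fin n) (Fin n) ℝ) (s : Fin n → ℝ) : Prop where
  mul_transpose_self : U * Uᵀ = 1
  transpose_mul_self : Uᵀ * U = 1
  gram : (U * A) * (U * A)ᵀ = diagonal (s ^ 2)
  antitone : Antitone s
  nonneg : ∀ j, 0 ≤ s j

theorem exists_isLeftSingular {n N : ℕ} (A : Matrix (Fin n) (Fin N) ℝ) :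
    ∃ U, A.IsLeftSingular U (singularValues A) := by
  set hH := isHermitian_mul_conjTranspose_self A
  set V : Matrix (Fin n) (Fin n) ℝ := (hH.eigenvectorUnitary : Matrix (Fin n) (Fin n) ℝ) with hV
  set g : Fin n → ℝ := fun j => -√(hH.eigenvalues j)
  have hs : singularValues A = fun j => √(hH.eigenvalues (Tuple.sort g j)) := by
    ext j; simp [singularValues, sortedDesc, g]
  have hV1 : Vᵀ * V = 1 := by
    simpa [star_eq_conjTranspose, hV] using Unitary.coe_star_mul_self hH.eigenvectorUnitary
  have hdiag : Vᵀ * (A * Aᵀ) * V = diagonal hH.eigenvalues := by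
    have h1 := hH.conjStarAlgAut_star_eigenvectorUnitary
    rw [Unitary.conjStarAlgAut_star_apply, star_eq_conjTranspose] at h1
    simpa [hV] using h1
  have hnn : ∀ j, 0 ≤ hH.eigenvalues j := (posSemidef_self_mul_conjTranspose A).eigenvalues_nonneg
  have hU : Vᵀ.submatrix (Tuple.sort g) id * (Vᵀ.submatrix (Tuple.sort g) id)ᵀ = 1 := by
    rw [transpose_submatrix, transpose_transpose,
      ← submatrix_mul _ _ _ _ _ Function.bijective_id, hV1]
    simp
  refine ⟨Vᵀ.submatrix (Tuple.sort g) id, hU, mul_eq_one_comm.1 hU, ?_, ?_, ?_⟩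
  · have h1 : Vᵀ.submatrix (Tuple.sort g) id * A = (Vᵀ * A).submatrix (Tuple.sort g) id := rfl
    have h2 : Vᵀ * A * (Vᵀ * A)ᵀ = diagonal hH.eigenvalues := by
      rw [← hdiag]; simp [Matrix.mul_assoc]
    rw [h1, transpose_submatrix, ← submatrix_mul _ _ _ _ _ Function.bijective_id, h2, hs,
      submatrix_diagonal_equiv]
    congr 1
    ext j
    exact (Real.sq_sqrt (hnn _)).symm
  · rw [hs]
    intro i j hij
    exact neg_le_neg_iff.1 (Tuple.monotone_sort g hij)
  · rw [hs]
    exact fun j => Real.sqrt_nonneg _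

namespace Matrix.IsLeftSingular

variable {n N : ℕ} {A : Matrix (Fin n) (Fin N) ℝ} {U : Matrix (Fin n) (Fin n) ℝ} {s : Fin n → ℝ}

theorem neg (h : A.IsLeftSingular U s) : (-A).IsLeftSingular U s :=
  ⟨h.mul_transpose_self, h.transpose_mul_self, by simpa using h.gram, h.antitone, h.nonneg⟩

theorem row_dotProduct_row (h : A.IsLeftSingular U s) (i j : Fin n) :
    (U * A) i ⬝ᵥ (U * A) j = if i = j then s i ^ 2 else 0 := by
  have := congrFun (congrFun h.gram i) j
  rwa [diagonal_apply] at this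

theorem row_eq_zero (h : A.IsLeftSingular U s) {j : Fin n} (hj : s j = 0) : (U * A) j = 0 := by
  rw [← dotProduct_self_eq_zero (R := ℝ), h.row_dotProduct_row]
  simp [hj]

theorem eq_zero_of_singular_values_eq_zero (h : A.IsLeftSingular U s) (hs : s = 0) : A = 0 := by
  have hUA : U * A = 0 := by
    ext i k
    exact congrFun (h.row_eq_zero (congrFun hs i)) k
  rw [← Matrix.one_mul A, ← h.transpose_mul_self, Matrix.mul_assoc, hUA, Matrix.mul_zero]

theorem eq_zero_of_rank_le (h : A.IsLeftSingular U s) {j : Fin n} (hj : A.rank ≤ j) :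
    s j = 0 := by
  classical
  by_contra hne
  have h1 : A.rank = Fintype.card {i // (s ^ 2) i ≠ 0} := by
    have hU : IsUnit U.det := (Matrix.isUnit_iff_isUnit_det _).1
      ⟨⟨U, Uᵀ, h.mul_transpose_self, h.transpose_mul_self⟩, rfl⟩
    rw [← Matrix.rank_diagonal, ← h.gram, rank_self_mul_transpose,
      rank_mul_eq_right_of_isUnit_det U A hU]
  have h2 : (j : ℕ) + 1 ≤ Fintype.card {i // (s ^ 2) i ≠ 0} := by
    rw [Fintype.card_subtype]
    calc (j : ℕ) + 1 = (Finset.Iic j).card := by simp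
      _ ≤ _ := Finset.card_le_card fun i hi => by
        have h3 := h.antitone (Finset.mem_Iic.1 hi)
        have h4 := (h.nonneg j).lt_of_ne (Ne.symm hne)
        have h5 : 0 < s i := h4.trans_le h3
        simp [h5.ne']
  omega

/-- The squared Frobenius norm of the weighted truncation `∑ⱼ dⱼ uⱼ uⱼᵀ A`. -/
theorem sum_sq_conj_diagonal (h : A.IsLeftSingular U s) (d : Fin n → ℝ) :
    ∑ i, ∑ k, (Uᵀ * diagonal d * (U * A)) i k ^ 2 = ∑ j, (d j * s j) ^ 2 := by
  set B := Uᵀ * diagonal d * (U * A)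
  have h1 : ∑ i, ∑ k, B i k ^ 2 = (B * Bᵀ).trace := by
    simp [trace, mul_apply, sq]
  have h2 : B * Bᵀ = Uᵀ * (diagonal d * ((U * A) * (U * A)ᵀ) * diagonal d * U) := by
    simp only [B, transpose_mul, diagonal_transpose, transpose_transpose, Matrix.mul_assoc]
  rw [h1, h2, trace_mul_comm, Matrix.mul_assoc, h.mul_transpose_self, h.gram, Matrix.mul_one]
  simp only [diagonal_mul_diagonal, trace_diagonal, Pi.pow_apply]
  exact Finset.sum_congr rfl fun j _ => by ring

theorem dotProduct_self_mulVec (h : A.IsLeftSingular U s) (x : Fin n → ℝ) :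
    (U *ᵥ x) ⬝ᵥ (U *ᵥ x) = x ⬝ᵥ x := by
  rw [dotProduct_mulVec, ← mulVec_transpose, mulVec_mulVec, h.transpose_mul_self, one_mulVec]

theorem vecMul_eq (h : A.IsLeftSingular U s) (x : Fin n → ℝ) :
    x ᵥ* A = (U *ᵥ x) ᵥ* (U * A) := by
  rw [← vecMul_transpose, vecMul_vecMul, ← Matrix.mul_assoc, h.transpose_mul_self, Matrix.one_mul]

theorem vecMul_dotProduct_vecMul (h : A.IsLeftSingular U s) (a b : Fin n → ℝ) :
    (a ᵥ* (U * A)) ⬝ᵥ (b ᵥ* (U * A)) = ∑ j, a j * b j * s j ^ 2 := by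
  rw [← mulVec_transpose (U * A) b, dotProduct_mulVec, vecMul_vecMul, h.gram,
    dotProduct]
  simp only [vecMul_diagonal, Pi.pow_apply]
  exact Finset.sum_congr rfl fun j _ => by ring

/-- The dilation of `A` is at least `s i` on a subspace of dimension more than `i`. -/
theorem exists_submodule_le_dilation (h : A.IsLeftSingular U s) (i : Fin n) :
    ∃ V : Submodule ℝ (Fin n ⊕ Fin N → ℝ), (i : ℕ) < Module.finrank ℝ V ∧
      ∀ z ∈ V, s i * (z ⬝ᵥ z) ≤ 2 * ((z ∘ Sum.inl) ᵥ* A ⬝ᵥ (z ∘ Sum.inr)) := by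
  have hz : ∀ z : Fin n ⊕ Fin N → ℝ, z ⬝ᵥ z =
      (z ∘ Sum.inl) ⬝ᵥ (z ∘ Sum.inl) + (z ∘ Sum.inr) ⬝ᵥ (z ∘ Sum.inr) := by
    intro z; simp [dotProduct, Fintype.sum_sum_type]
  -- embed coefficient vectors supported on the first `i + 1` coordinates
  let ext : (Fin (i + 1) → ℝ) →ₗ[ℝ] (Fin n → ℝ) :=
    LinearMap.pi fun j => if hj : (j : ℕ) < i + 1 then LinearMap.proj ⟨j, hj⟩ else 0
  have hext : Function.Injective ext := by
    intro a b hab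
    ext k
    have := congrFun hab ⟨k, by omega⟩
    have hk : (k : ℕ) < i + 1 := k.2
    simpa only [ext, LinearMap.pi_apply, hk, dif_pos, LinearMap.proj_apply] using this
  have hext0 : ∀ a j, i < j → ext a j = 0 := by
    intro a j hj
    have : ¬ (j : ℕ) < i + 1 := by rw [Fin.lt_def] at hj; omega
    simp only [ext, LinearMap.pi_apply, this, dif_neg, not_false_eq_true, LinearMap.zero_apply]
  let F : (Fin n → ℝ) →ₗ[ℝ] (Fin n ⊕ Fin N → ℝ) :=
    { toFun := fun a => Sum.elim (Uᵀ *ᵥ a) ((fun j => (s j)⁻¹ * a j) ᵥ* (U * A))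
      map_add' := by
        intro a b
        have : (fun j => (s j)⁻¹ * (a + b) j) =
            (fun j => (s j)⁻¹ * a j) + fun j => (s j)⁻¹ * b j := by
          ext j; simp [mul_add]
        rw [this, mulVec_add, add_vecMul, Sum.elim_add_add]
      map_smul' := by
        intro t a
        have : (fun j => (s j)⁻¹ * (t • a) j) = t • (fun j => (s j)⁻¹ * a j) := by
          ext j; simp; ring
        rw [this, mulVec_smul, smul_vecMul]
        ext (j | j) <;> simp }
  have hUF : ∀ a, U *ᵥ (F a ∘ Sum.inl) = a := by
    intro a
    simp only [F, LinearMap.coe_mk, AddHom.coe_mk, Sum.elim_comp_inl, mulVec_mulVec,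
      h.mul_transpose_self, one_mulVec]
  have hF : Function.Injective F := fun a b hab => by rw [← hUF a, hab, hUF]
  refine ⟨LinearMap.range (F ∘ₗ ext), ?_, ?_⟩
  · rw [LinearMap.finrank_range_of_inj (by simpa using hF.comp hext)]
    simp
  rintro _ ⟨a', rfl⟩
  set a := ext a' with ha
  have h1 : (F a ∘ Sum.inl) ⬝ᵥ (F a ∘ Sum.inl) = ∑ j, a j ^ 2 := by
    rw [← h.dotProduct_self_mulVec, hUF]
    simp [dotProduct, sq]
  have hinr : F a ∘ Sum.inr = (fun j => (s j)⁻¹ * a j) ᵥ* (U * A) := by simp [F]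
  rw [LinearMap.comp_apply, hz, h1, h.vecMul_eq, hUF, hinr, h.vecMul_dotProduct_vecMul,
    h.vecMul_dotProduct_vecMul, ← Finset.sum_add_distrib, Finset.mul_sum, Finset.mul_sum]
  refine Finset.sum_le_sum fun j _ => ?_
  rcases lt_or_ge i j with hj | hj
  · simp [ha, hext0 a' j hj]
  · have h2 := h.antitone hj
    have h3 := h.nonneg i
    have h4 := h.nonneg j
    rcases h4.eq_or_lt with h5 | h5
    · have : s i = 0 := by linarith
      simp [this, ← h5]
    · have e1 : (s j)⁻¹ * a j * ((s j)⁻¹ * a j) * s j ^ 2 = a j ^ 2 := by field_simp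
      have e2 : a j * ((s j)⁻¹ * a j) * s j ^ 2 = s j * a j ^ 2 := by field_simp
      rw [e1, e2]
      nlinarith [sq_nonneg (a j)]

/-- The dilation of `A` is at least `-s i` on a subspace of codimension at most `i`. -/
theorem exists_submodule_neg_le_dilation (h : A.IsLeftSingular U s) (i : Fin n) :
    ∃ V : Submodule ℝ (Fin n ⊕ Fin N → ℝ), n + N ≤ Module.finrank ℝ V + i ∧
      ∀ z ∈ V, -s i * (z ⬝ᵥ z) ≤ 2 * ((z ∘ Sum.inl) ᵥ* A ⬝ᵥ (z ∘ Sum.inr)) := by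
  let f : (Fin n ⊕ Fin N → ℝ) →ₗ[ℝ] (Fin i → ℝ) :=
    (LinearMap.funLeft ℝ ℝ fun k : Fin i => (⟨k, k.2.trans i.2⟩ : Fin n)) ∘ₗ
      U.mulVecLin ∘ₗ LinearMap.funLeft ℝ ℝ Sum.inl
  refine ⟨LinearMap.ker f, ?_, fun z hz => ?_⟩
  · have h1 := f.finrank_range_add_finrank_ker
    have h2 := Submodule.finrank_le (LinearMap.range f)
    simp only [Module.finrank_fintype_fun_eq_card, Fintype.card_sum, Fintype.card_fin] at h1 h2
    omega
  set x := z ∘ Sum.inl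
  set y := z ∘ Sum.inr
  have hzz : z ⬝ᵥ z = x ⬝ᵥ x + y ⬝ᵥ y := by simp [x, y, dotProduct, Fintype.sum_sum_type]
  set a := U *ᵥ x with ha
  have ha0 : ∀ j < i, a j = 0 := by
    intro j hj
    exact congrFun (LinearMap.mem_ker.1 hz) ⟨j, hj⟩
  have h1 : (x ᵥ* A) ⬝ᵥ (x ᵥ* A) ≤ s i ^ 2 * (x ⬝ᵥ x) := by
    rw [h.vecMul_eq, h.vecMul_dotProduct_vecMul, ← h.dotProduct_self_mulVec, dotProduct,
      Finset.mul_sum]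
    refine Finset.sum_le_sum fun j _ => ?_
    rcases lt_or_ge j i with hj | hj
    · simp [← ha, ha0 j hj]
    · have h2 := h.antitone hj
      have h3 := h.nonneg j
      have : s j ^ 2 ≤ s i ^ 2 := by gcongr
      nlinarith [mul_self_nonneg (a j)]
  have hnn : ∀ v : Fin N → ℝ, 0 ≤ v ⬝ᵥ v := fun v =>
    Finset.sum_nonneg fun i _ => mul_self_nonneg _
  rcases (h.nonneg i).eq_or_lt with h0 | h0
  · rw [← h0] at h1
    have h2 : x ᵥ* A = 0 := by
      rw [← dotProduct_self_eq_zero (R := ℝ)]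
      exact le_antisymm (by simpa using h1) (hnn _)
    simp [h2, ← h0]
  · have h2 := hnn (x ᵥ* A + s i • y)
    simp only [add_dotProduct, dotProduct_add, smul_dotProduct, dotProduct_smul,
      smul_eq_mul] at h2
    rw [dotProduct_comm y (x ᵥ* A)] at h2
    rw [hzz]
    refine le_of_mul_le_mul_left ?_ h0
    linarith

/-- The blocks `|Aᵀ|` and `|A|` completing the dilation of `A` to a positive semidefinite
form. -/
theorem exists_absolute_value_blocks (h : A.IsLeftSingular U s) :
    ∃ (W₁ : Matrix (Fin n) (Fin n) ℝ) (W₂ : Matrix (Fin N) (Fin N) ℝ),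
      W₁ᵀ = W₁ ∧ W₂ᵀ = W₂ ∧ W₁.trace = ∑ j, s j ∧ W₂.trace = ∑ j, s j ∧
      ∀ x y, |2 * (x ᵥ* A ⬝ᵥ y)| ≤ x ⬝ᵥ W₁ *ᵥ x + y ⬝ᵥ W₂ *ᵥ y := by
  refine ⟨Uᵀ * diagonal s * U, (U * A)ᵀ * diagonal (s⁻¹) * (U * A), ?_, ?_, ?_, ?_, ?_⟩
  · simp [Matrix.mul_assoc]
  · simp [Matrix.mul_assoc]
  · rw [trace_mul_comm, ← Matrix.mul_assoc, h.mul_transpose_self, Matrix.one_mul, trace_diagonal]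
  · rw [trace_mul_comm, ← Matrix.mul_assoc, h.gram, diagonal_mul_diagonal, trace_diagonal]
    refine Finset.sum_congr rfl fun j _ => ?_
    rcases eq_or_ne (s j) 0 with h0 | h0
    · simp [h0]
    · simp only [Pi.pow_apply, Pi.inv_apply]; field_simp
  · intro x y
    have key : ∀ {k : ℕ} (P : Matrix (Fin n) (Fin k) ℝ) (d : Fin n → ℝ) (v : Fin k → ℝ),
        v ⬝ᵥ (Pᵀ * diagonal d * P) *ᵥ v = ∑ j, d j * (P *ᵥ v) j ^ 2 := by
      intro k P d v
      rw [← mulVec_mulVec, ← mulVec_mulVec, dotProduct_mulVec, vecMul_transpose, dotProduct]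
      simp only [mulVec_diagonal]
      exact Finset.sum_congr rfl fun j _ => by ring
    rw [key, key, h.vecMul_eq, ← dotProduct_mulVec, dotProduct, Finset.mul_sum,
      ← Finset.sum_add_distrib]
    refine (Finset.abs_sum_le_sum_abs _ _).trans (Finset.sum_le_sum fun j _ => ?_)
    set p := (U *ᵥ x) j
    set q := ((U * A) *ᵥ y) j with hq
    rcases (h.nonneg j).eq_or_lt with h0 | h0
    · have : q = 0 := by
        rw [hq, mulVec, h.row_eq_zero h0.symm, zero_dotProduct]
      simp [this, ← h0]
    · have e1 : s j * p ^ 2 + (s⁻¹) j * q ^ 2 = (s j)⁻¹ * ((s j * p) ^ 2 + q ^ 2) := by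
        simp only [Pi.inv_apply]; field_simp
      have e2 : |2 * (p * q)| = (s j)⁻¹ * |2 * (s j * p * q)| := by
        conv_rhs => rw [← abs_of_pos (inv_pos.2 h0), ← abs_mul]
        congr 1; field_simp
      rw [e1, e2]
      have := inv_pos.2 h0
      gcongr
      rw [abs_le]
      constructor <;> nlinarith [sq_nonneg (s j * p + q), sq_nonneg (s j * p - q)]

/-- A Mirsky-type inequality: adding a matrix of rank at most `r` to `M` lowers the nuclear norm
of the tail of `M` by no more than the nuclear norm of its head. -/
theorem sum_add_sum_tail_sub_sum_head_le {M : Matrix (Fin n) (Fin N) ℝ}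
    {V W : Matrix (Fin n) (Fin n) ℝ} {t z : Fin n → ℝ} {r : ℕ} (hA : A.IsLeftSingular U s)
    (hM : M.IsLeftSingular V t) (hZ : (A + M).IsLeftSingular W z) (hnN : n ≤ N)
    (hr : A.rank ≤ r) (hrn : r ≤ n) :
    ∑ j, s j + ∑ j ∈ Finset.univ.filter (fun j : Fin n => r ≤ (j : ℕ)), t j
      - ∑ j ∈ Finset.univ.filter (fun j : Fin n => (j : ℕ) < r), t j ≤ ∑ j, z j := by
  obtain ⟨l, rfl⟩ := Nat.exists_eq_add_of_le hnN
  obtain ⟨W₁, W₂, hW₁, hW₂, htr₁, htr₂, hW⟩ := hZ.exists_absolute_value_blocks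
  set R := fromBlocks ((1 / 2 : ℝ) • W₁) ((1 / 2 : ℝ) • (A - M)) ((1 / 2 : ℝ) • (A - M)ᵀ)
    ((1 / 2 : ℝ) • W₂) with hR
  have hRherm : R.IsHermitian := by
    rw [IsHermitian, conjTranspose_eq_transpose_of_trivial, hR, fromBlocks_transpose]
    simp only [transpose_smul, transpose_transpose, hW₁, hW₂]
  have htr : R.trace = ∑ j, z j := by
    have h1 : R.trace = (1 / 2 : ℝ) * W₁.trace + (1 / 2 : ℝ) * W₂.trace := by
      simp [hR, trace, Finset.mul_sum]
    rw [h1, htr₁, htr₂]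
    ring
  have hform : ∀ v, v ⬝ᵥ R *ᵥ v = 1 / 2 * ((v ∘ Sum.inl) ⬝ᵥ W₁ *ᵥ (v ∘ Sum.inl)
      + (v ∘ Sum.inr) ⬝ᵥ W₂ *ᵥ (v ∘ Sum.inr)
      + 2 * ((v ∘ Sum.inl) ᵥ* A ⬝ᵥ (v ∘ Sum.inr) - (v ∘ Sum.inl) ᵥ* M ⬝ᵥ (v ∘ Sum.inr))) := by
    intro v
    set x := v ∘ Sum.inl
    set y := v ∘ Sum.inr
    have hv : v = Sum.elim x y := by ext (i | i) <;> rfl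
    have h1 : y ⬝ᵥ (A - M)ᵀ *ᵥ x = x ᵥ* A ⬝ᵥ y - x ᵥ* M ⬝ᵥ y := by
      rw [mulVec_transpose, dotProduct_comm, vecMul_sub, sub_dotProduct]
    have h2 : x ⬝ᵥ (A - M) *ᵥ y = x ᵥ* A ⬝ᵥ y - x ᵥ* M ⬝ᵥ y := by
      rw [dotProduct_mulVec, vecMul_sub, sub_dotProduct]
    rw [hv, hR, fromBlocks_mulVec, sumElim_dotProduct_sumElim, Sum.elim_comp_inl,
      Sum.elim_comp_inr]
    simp only [smul_mulVec, dotProduct_add, dotProduct_smul, smul_eq_mul, h1, h2]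
    ring
  have hge : ∀ v, 2 * ((v ∘ Sum.inl) ᵥ* A ⬝ᵥ (v ∘ Sum.inr)) ≤ v ⬝ᵥ R *ᵥ v ∧
      2 * ((v ∘ Sum.inl) ᵥ* (-M) ⬝ᵥ (v ∘ Sum.inr)) ≤ v ⬝ᵥ R *ᵥ v := by
    intro v
    have h1 := abs_le.1 (hW (v ∘ Sum.inl) (v ∘ Sum.inr))
    rw [vecMul_add, add_dotProduct] at h1
    rw [hform, vecMul_neg, neg_dotProduct]
    constructor <;> linarith [h1.1, h1.2]
  set c₁ : Fin n → ℝ := fun j => if (j : ℕ) < r then s j else t j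
  set c₂ : Fin (n + l) → ℝ := Fin.append (fun j : Fin n => if (j : ℕ) < r then -t j else 0) 0
  have hker : ∀ k : ℕ, r ≤ k → k < n + l → ∃ V : Submodule ℝ (Fin n ⊕ Fin (n + l) → ℝ),
      n + (n + l - (k + 1)) < Module.finrank ℝ V ∧ ∀ v ∈ V, 0 * (v ⬝ᵥ v) ≤ v ⬝ᵥ R *ᵥ v := by
    intro k hk hkl
    let f := A.mulVecLin ∘ₗ LinearMap.funLeft ℝ ℝ (Sum.inr : Fin (n + l) → Fin n ⊕ Fin (n + l))
    refine ⟨LinearMap.ker f, ?_, fun v hv => ?_⟩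
    · have h1 := f.finrank_range_add_finrank_ker
      have h2 : Module.finrank ℝ (LinearMap.range f) ≤ r :=
        (Submodule.finrank_mono (LinearMap.range_comp_le_range _ _)).trans hr
      simp only [Module.finrank_fintype_fun_eq_card, Fintype.card_sum, Fintype.card_fin] at h1
      omega
    · have h1 : A *ᵥ (v ∘ Sum.inr) = 0 := LinearMap.mem_ker.1 hv
      have h2 := (hge v).1
      rw [← dotProduct_mulVec, h1, dotProduct_zero] at h2
      linarith
  have hmain := hRherm.sum_le_trace_of_forall_lt_finrank (d := n + (n + l)) (by simp)
    (Fin.append c₁ fun k => c₂ k.rev) (by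
      refine Fin.addCases (fun j => ?_) fun k => ?_
      · rw [Fin.append_left, Fin.val_castAdd]
        by_cases hj : (j : ℕ) < r
        · obtain ⟨V, hV, hVA⟩ := hA.exists_submodule_le_dilation j
          refine ⟨V, hV, fun v hv => ?_⟩
          simpa only [c₁, hj, if_true] using (hVA v hv).trans (hge v).1
        · obtain ⟨V, hV, hVM⟩ := hM.neg.exists_submodule_le_dilation j
          refine ⟨V, hV, fun v hv => ?_⟩
          simpa only [c₁, hj, if_false] using (hVM v hv).trans (hge v).2
      · obtain ⟨k, rfl⟩ := Fin.rev_surjective k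
        rw [Fin.append_right, Fin.rev_rev, Fin.val_natAdd, Fin.val_rev]
        induction k using Fin.addCases with
        | left j =>
          by_cases hj : (j : ℕ) < r
          · obtain ⟨V, hV, hVM⟩ := hM.neg.exists_submodule_neg_le_dilation j
            refine ⟨V, by rw [Fin.val_castAdd]; omega, fun v hv => ?_⟩
            simpa only [c₂, Fin.append_left, hj, if_true] using (hVM v hv).trans (hge v).2
          · simpa only [c₂, Fin.append_left, Fin.val_castAdd, hj, if_false] using
              hker j (not_lt.1 hj) (by omega)
        | right k =>
          simpa only [c₂, Fin.append_right, Fin.val_natAdd, Pi.zero_apply] using hker (n + k) (by omega) (by omega))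
  rw [htr, Fin.sum_univ_add] at hmain
  simp only [Fin.append_left, Fin.append_right] at hmain
  have hc₂ : ∑ k : Fin (n + l), c₂ k.rev =
      -∑ j ∈ Finset.univ.filter (fun j : Fin n => (j : ℕ) < r), t j := by
    rw [← Equiv.sum_comp Fin.revPerm]
    simp only [Fin.revPerm_apply, Fin.rev_rev]
    rw [Fin.sum_univ_add]
    simp only [c₂, Fin.append_left, Fin.append_right, Pi.zero_apply, Finset.sum_const_zero,
      add_zero, ← Finset.sum_filter, Finset.sum_neg_distrib]
  have hc₁ : ∑ j, c₁ j = ∑ j, s j +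
      ∑ j ∈ Finset.univ.filter (fun j : Fin n => r ≤ (j : ℕ)), t j := by
    rw [Finset.sum_filter, ← Finset.sum_add_distrib]
    refine Finset.sum_congr rfl fun j _ => ?_
    by_cases hj : (j : ℕ) < r
    · simp [c₁, hj]
    · simp [c₁, hj, not_lt.1 hj, hA.eq_zero_of_rank_le (hr.trans (not_lt.1 hj))]
  rw [hc₁, hc₂] at hmain
  linarith

end Matrix.IsLeftSingular

/-- **Rank-`2r` RIP with constant `δ < 1/3` implies the rank-`r` null space property**, and
hence every matrix of rank at most `r` is the unique minimizer of the nuclear norm subject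
to the measurement constraint. -/
theorem rank_RIP_implies_rank_NSP {n N m : ℕ} (hnN : n ≤ N) (r : ℕ)
    (hr1 : 1 ≤ r) (hrn : 2 * r ≤ n)
    (X : Matrix (Fin n) (Fin N) ℝ →ₗ[ℝ] (Fin m → ℝ))
    (δ : ℝ) (hδ0 : 0 ≤ δ) (hδ : δ < 1 / 3)
    (hRIP : ∀ A : Matrix (Fin n) (Fin N) ℝ, A.rank ≤ 2 * r →
      (1 - δ) * (∑ i, ∑ k, A i k ^ 2) ≤ ∑ i, (X A i) ^ 2 ∧
        ∑ i, (X A i) ^ 2 ≤ (1 + δ) * (∑ i, ∑ k, A i k ^ 2)) :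
    (∀ M : Matrix (Fin n) (Fin N) ℝ, M ≠ 0 → X M = 0 →
        ∑ j ∈ Finset.univ.filter (fun j : Fin n => (j : ℕ) < r), singularValues M j
          < ∑ j ∈ Finset.univ.filter (fun j : Fin n => r ≤ (j : ℕ)), singularValues M j) ∧
    (∀ A : Matrix (Fin n) (Fin N) ℝ, A.rank ≤ r →
        ∀ Z : Matrix (Fin n) (Fin N) ℝ, X Z = X A → Z ≠ A →
          ∑ j, singularValues A j < ∑ j, singularValues Z j) := by
  have hnsp : ∀ M : Matrix (Fin n) (Fin N) ℝ, M ≠ 0 → X M = 0 →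
      ∑ j ∈ Finset.univ.filter (fun j : Fin n => (j : ℕ) < r), singularValues M j
        < ∑ j ∈ Finset.univ.filter (fun j : Fin n => r ≤ (j : ℕ)), singularValues M j := by
    intro M hM hXM
    obtain ⟨U, hU⟩ := exists_isLeftSingular M
    let B : (Fin n → ℝ) →ₗ[ℝ] Matrix (Fin n) (Fin N) ℝ :=
      { toFun := fun d => Uᵀ * diagonal d * (U * M)
        map_add' := fun d d' => by
          rw [← Matrix.add_mul, ← Matrix.mul_add, diagonal_add]; rfl
        map_smul' := fun a d => by
          rw [RingHom.id_apply, ← Matrix.smul_mul, ← Matrix.mul_smul, diagonal_smul] }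
    have hB1 : B 1 = M := by
      change Uᵀ * diagonal (fun _ => 1) * (U * M) = M
      rw [diagonal_one, Matrix.mul_one, ← Matrix.mul_assoc, hU.transpose_mul_self, Matrix.one_mul]
    refine sum_head_lt_sum_tail_of_RIP hr1 hU.antitone hU.nonneg (fun h0 => hM ?_) (X ∘ₗ B) hδ0 hδ
      (fun d hd => ?_) (by rw [LinearMap.comp_apply, hB1, hXM])
    · exact hU.eq_zero_of_singular_values_eq_zero h0
    · have hrank : (B d).rank ≤ 2 * r := by
        refine le_trans ?_ hd
        exact Matrix.rank_mul_diagonal_mul_le _ _ _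
      have h1 := hRIP (B d) hrank
      have h2 : ∑ i, ∑ k, B d i k ^ 2 = _ := hU.sum_sq_conj_diagonal d
      rw [h2] at h1
      simpa only [dotProduct, LinearMap.comp_apply, ← sq] using h1
  refine ⟨hnsp, fun A hA Z hZ hne => ?_⟩
  obtain ⟨U, hU⟩ := exists_isLeftSingular A
  obtain ⟨V, hV⟩ := exists_isLeftSingular (Z - A)
  obtain ⟨W, hW⟩ := exists_isLeftSingular Z
  have h1 := hnsp (Z - A) (sub_ne_zero.2 hne) (by rw [map_sub, hZ, sub_self])
  have h2 := hU.sum_add_sum_tail_sub_sum_head_le hV (by rwa [add_sub_cancel]) hnN hA (by omega)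
  linarith
end
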